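/- For every prime p ≥ 5, ss_p^{(3*)}(X)² = X^δ·(X − 108)^δ · Σ_{n=0}^{(p−1+2δ)/3} C(2n,n)²·C(3n,n)·X^{(p−1+2δ)/3 − n} as polynomials in 𝔽_p[X] (the binomial coefficients being reduced mod p). -/

import Mathlib

open Polynomial

noncomputable section

/-- The class number h(√-d) of the imaginary quadratic field ℚ(√-d),
realized as the subfield of ℂ generated by i·√d. -/
def classNumberSqrtNeg (d : ℕ) : ℕ :=
  haveI : FiniteDimensional ℚ (IntermediateField.adjoin ℚ {(Complex.I * Real.sqrt d : ℂ)}) :=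
    IntermediateField.adjoin.finiteDimensional
      ⟨X ^ 2 + C (d : ℚ), monic_X_pow_add_C _ (by norm_num), by
        have h : (Complex.I * (Real.sqrt d : ℂ)) ^ 2 = -(d : ℂ) := by
          rw [mul_pow, Complex.I_sq, ← Complex.ofReal_pow, Real.sq_sqrt (Nat.cast_nonneg d)]
          simp
        simp [h]⟩
  haveI : NumberField (IntermediateField.adjoin ℚ {(Complex.I * Real.sqrt d : ℂ)}) := ⟨⟩
  NumberField.classNumber (IntermediateField.adjoin ℚ {(Complex.I * Real.sqrt d : ℂ)})

variable (p : ℕ) [Fact p.Prime]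

/-- ε = (1 - (-1|p))/2 -/
def eps : ℕ := ((1 - legendreSym p (-1)) / 2).toNat
/-- δ = (1 - (-3|p))/2 -/
def del : ℕ := ((1 - legendreSym p (-3)) / 2).toNat
/-- ν = (1 - (-2|p))/2 -/
def nu : ℕ := ((1 - legendreSym p (-2)) / 2).toNat

/-- The Pochhammer symbol (x)_n = x(x+1)⋯(x+n-1) in 𝔽_p. -/
def poch (x : ZMod p) (n : ℕ) : ZMod p := (ascPochhammer (ZMod p) n).eval x

/-- The level-3 Fricke supersingular polynomial ss_p^{(3*)}(X) ∈ 𝔽_p[X]: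
(X-108)^δ · Σ_{n=0}^{m₃} ((-m₃)_n (β₃)_n / (n!)²) 108^n X^{m₃+δ-n},
with m₃ = ⌊p/6⌋ and β₃ = 1/3 + δ/3. -/
def ss3Star : (ZMod p)[X] :=
  (X - C 108) ^ del p *
    ∑ n ∈ Finset.range (p / 6 + 1),
      C (poch p (-(p / 6 : ℕ) : ZMod p) n *
         poch p ((1 : ZMod p) / 3 + (del p : ZMod p) / 3) n /
         ((n.factorial : ZMod p)) ^ 2 * 108 ^ n) *
      X ^ (p / 6 + del p - n)

/-- L^{(3*)}(p): the number of distinct roots of ss_p^{(3*)}(X) in 𝔽_p. -/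
def L3Star : ℕ := (ss3Star p).roots.toFinset.card

section EulerOperator

variable {R : Type*} [CommRing R]

/-- The Euler operator `θ = X · d/dX`. -/
def eulerOp (f : R[X]) : R[X] := X * derivative f

theorem eulerOp_add (f g : R[X]) : eulerOp (f + g) = eulerOp f + eulerOp g := by
  simp only [eulerOp, derivative_add]; ring

theorem eulerOp_sub (f g : R[X]) : eulerOp (f - g) = eulerOp f - eulerOp g := by
  simp only [eulerOp, derivative_sub]; ring

theorem eulerOp_mul (f g : R[X]) : eulerOp (f * g) = eulerOp f * g + f * eulerOp g := by
  simp only [eulerOp, derivative_mul]; ring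

theorem eulerOp_X : eulerOp (X : R[X]) = X := by simp [eulerOp]

theorem eulerOp_zero : eulerOp (0 : R[X]) = 0 := by simp [eulerOp]

theorem eulerOp_one : eulerOp (1 : R[X]) = 0 := by simp [eulerOp]

theorem eulerOp_ofNat (k : ℕ) [k.AtLeastTwo] : eulerOp (ofNat(k) : R[X]) = 0 := by
  simp [eulerOp]

theorem coeff_eulerOp (f : R[X]) (n : ℕ) : (eulerOp f).coeff n = n * f.coeff n := by
  cases n with
  | zero => simp [eulerOp]
  | succ n => simp [eulerOp, coeff_X_mul, coeff_derivative, mul_comm]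

/-- The hypergeometric equation `θ² f = X (aθ² + bθ + c) f` in terms of coefficients. -/
theorem eulerOp_eulerOp_eq_of_coeff {F : R[X]} {a b c : R}
    (h : ∀ n : ℕ, ((n : R) + 1) ^ 2 * F.coeff (n + 1) = (a * n ^ 2 + b * n + c) * F.coeff n) :
    eulerOp (eulerOp F) = X * (C a * eulerOp (eulerOp F) + C b * eulerOp F + C c * F) := by
  ext n
  cases n with
  | zero => simp [coeff_eulerOp]
  | succ n =>
    simp only [coeff_eulerOp, coeff_X_mul, coeff_add, coeff_C_mul, Nat.cast_add, Nat.cast_one]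
    linear_combination h n

/-- Clausen's formula for `₂F₁(1/6, 1/3; 1; 108X)²`, as a differential equation. -/
theorem eulerOp_sq_of_eulerOp_eq {F : R[X]}
    (h : eulerOp (eulerOp F) =
      X * (108 * eulerOp (eulerOp F) + 54 * eulerOp F + 6 * F)) :
    eulerOp (eulerOp (eulerOp (F * F))) =
      X * (108 * eulerOp (eulerOp (eulerOp (F * F))) + 162 * eulerOp (eulerOp (F * F)) +
        78 * eulerOp (F * F) + 12 * (F * F)) := by
  have h' := congrArg eulerOp h
  simp only [eulerOp_add, eulerOp_mul, eulerOp_X, eulerOp_ofNat] at h' ⊢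
  linear_combination 2 * F * h' + 6 * eulerOp F * h

/-- Clausen's formula combined with Euler's transformation: the differential equation of
`(1 - 108X) ₂F₁(5/6, 2/3; 1; 108X)²`. -/
theorem eulerOp_one_sub_mul_sq_of_eulerOp_eq {F : R[X]}
    (h : eulerOp (eulerOp F) =
      X * (108 * eulerOp (eulerOp F) + 162 * eulerOp F + 60 * F)) :
    eulerOp (eulerOp (eulerOp ((1 - 108 * X) * (F * F)))) =
      X * (108 * eulerOp (eulerOp (eulerOp ((1 - 108 * X) * (F * F)))) +
        162 * eulerOp (eulerOp ((1 - 108 * X) * (F * F))) +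
        78 * eulerOp ((1 - 108 * X) * (F * F)) + 12 * ((1 - 108 * X) * (F * F))) := by
  have h' := congrArg eulerOp h
  simp only [eulerOp_add, eulerOp_sub, eulerOp_mul, eulerOp_X, eulerOp_ofNat, eulerOp_one,
    eulerOp_zero] at h' ⊢
  linear_combination 2 * (1 - 108 * X) * F * h' + 6 * (1 - 108 * X) * eulerOp F * h -
    4 * 108 * X * F * h

end EulerOperator

section Truncation

variable {R : Type*} [CommRing R]

/-- The polynomial `∑_{n ≤ N} cₙ Xⁿ`. -/
def truncPoly (c : ℕ → R) (N : ℕ) : R[X] := ∑ n ∈ Finset.range (N + 1), C (c n) * X ^ n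

theorem coeff_truncPoly (c : ℕ → R) (N n : ℕ) :
    (truncPoly c N).coeff n = if n ≤ N then c n else 0 := by
  simp [truncPoly, coeff_C_mul, coeff_X_pow]

theorem natDegree_truncPoly_le (c : ℕ → R) (N : ℕ) : (truncPoly c N).natDegree ≤ N := by
  rw [natDegree_le_iff_coeff_eq_zero]
  intro n hn
  rw [coeff_truncPoly, if_neg (by omega)]

theorem eq_truncPoly {f : R[X]} {c : ℕ → R} {N : ℕ} (hf : f.natDegree ≤ N)
    (h : ∀ n ≤ N, f.coeff n = c n) : f = truncPoly c N := by
  ext n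
  rw [coeff_truncPoly]
  split_ifs with hn
  · exact h n hn
  · exact coeff_eq_zero_of_natDegree_lt (by omega)

theorem reflect_truncPoly (c : ℕ → R) (N : ℕ) :
    reflect N (truncPoly c N) = ∑ n ∈ Finset.range (N + 1), C (c n) * X ^ (N - n) := by
  ext n
  rw [coeff_reflect, coeff_truncPoly]
  simp only [finsetSum_coeff, coeff_C_mul, coeff_X_pow]
  by_cases hn : n ≤ N
  · rw [revAt_le hn, if_pos (by omega), Finset.sum_eq_single (N - n)]
    · rw [if_pos (by omega), mul_one]
    · intro k hk hkn
      rw [if_neg, mul_zero]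
      have := Finset.mem_range.mp hk
      omega
    · intro hk
      exact absurd (Finset.mem_range.mpr (by omega)) hk
  · rw [revAt_eq_self_of_lt (by omega), if_neg hn, Finset.sum_eq_zero]
    intro k hk
    rw [if_neg (by omega), mul_zero]

end Truncation

theorem succ_mul_choose_three_mul (n : ℕ) :
    2 * (2 * n + 1) * ((n + 1) * (3 * (n + 1)).choose (n + 1)) =
      3 * (3 * n + 1) * (3 * n + 2) * (3 * n).choose n := by
  have h₀ := Nat.choose_mul_factorial_mul_factorial (show n ≤ 3 * n by omega)
  have h₁ := Nat.choose_mul_factorial_mul_factorial (show n + 1 ≤ 3 * (n + 1) by omega)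
  rw [show 3 * n - n = 2 * n by omega] at h₀
  rw [show 3 * (n + 1) - (n + 1) = 2 * n + 1 + 1 by omega, show 3 * (n + 1) = 3 * n + 2 + 1 by ring]
    at h₁
  simp only [Nat.factorial_succ] at h₁
  rw [← h₀] at h₁
  have hpos : 0 < n.factorial * (2 * n).factorial * (n + 1) := by positivity
  refine Nat.eq_of_mul_eq_mul_left hpos ?_
  rw [show 3 * (n + 1) = 3 * n + 2 + 1 by ring]
  linarith

theorem succ_pow_three_mul_choose_sq_mul_choose (n : ℕ) :
    (n + 1) ^ 3 * ((2 * (n + 1)).choose (n + 1) ^ 2 * (3 * (n + 1)).choose (n + 1)) =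
      6 * (2 * n + 1) * (3 * n + 1) * (3 * n + 2) * ((2 * n).choose n ^ 2 * (3 * n).choose n) := by
  have h₂ := Nat.succ_mul_centralBinom_succ n
  have h₃ := succ_mul_choose_three_mul n
  simp only [Nat.centralBinom_eq_two_mul_choose] at h₂
  refine Nat.eq_of_mul_eq_mul_left (show 0 < 2 * (2 * n + 1) by positivity) ?_
  calc _ = ((n + 1) * (2 * (n + 1)).choose (n + 1)) ^ 2 *
        (2 * (2 * n + 1) * ((n + 1) * (3 * (n + 1)).choose (n + 1))) := by ring
    _ = _ := by rw [h₂, h₃]; ring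

/-- The reduction mod `p` of `C(2n,n)² C(3n,n)`. -/
def clausenCoeff (n : ℕ) : ZMod p :=
  (((2 * n).choose n : ℕ) : ZMod p) ^ 2 * (((3 * n).choose n : ℕ) : ZMod p)

theorem natCast_ne_zero_of_pos_of_lt {n : ℕ} (h0 : 0 < n) (hn : n < p) : (n : ZMod p) ≠ 0 := by
  rw [Ne, ZMod.natCast_eq_zero_iff]
  exact Nat.not_dvd_of_pos_of_lt h0 hn

theorem succ_pow_three_mul_clausenCoeff_succ (n : ℕ) :
    ((n : ZMod p) + 1) ^ 3 * clausenCoeff p (n + 1) =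
      (108 * n ^ 3 + 162 * n ^ 2 + 78 * n + 12) * clausenCoeff p n := by
  have h := congrArg (Nat.cast (R := ZMod p)) (succ_pow_three_mul_choose_sq_mul_choose n)
  push_cast at h
  simp only [clausenCoeff]
  linear_combination h

theorem coeff_eq_clausenCoeff {G : (ZMod p)[X]} (h0 : G.coeff 0 = 1)
    (h : eulerOp (eulerOp (eulerOp G)) = X * (108 * eulerOp (eulerOp (eulerOp G)) +
      162 * eulerOp (eulerOp G) + 78 * eulerOp G + 12 * G)) {n : ℕ} (hn : n < p) :
    G.coeff n = clausenCoeff p n := by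
  induction n with
  | zero => simp [h0, clausenCoeff]
  | succ n ih =>
    have hne := natCast_ne_zero_of_pos_of_lt p n.succ_pos hn
    have hc := congrArg (fun f => coeff f (n + 1)) h
    simp only [coeff_X_mul, coeff_add, coeff_ofNat_mul, coeff_eulerOp] at hc
    rw [ih (by omega)] at hc
    refine mul_left_cancel₀ (pow_ne_zero 3 hne) ?_
    push_cast at hc ⊢
    linear_combination hc - succ_pow_three_mul_clausenCoeff_succ p n

theorem clausenCoeff_eq_zero {n : ℕ} (hn : 2 ≤ n) (h : 3 * n = p + 1) : clausenCoeff p n = 0 := by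
  have hprime : p.Prime := Fact.out
  have hdvd : p ∣ (3 * n).choose n := by
    have h₁ := Nat.choose_mul_factorial_mul_factorial (show n ≤ 3 * n by omega)
    have h₂ : p ∣ (3 * n).choose n * n.factorial * (3 * n - n).factorial := by
      rw [h₁]
      exact hprime.dvd_factorial.mpr (by omega)
    rcases hprime.dvd_mul.mp h₂ with h₂ | h₂
    · rcases hprime.dvd_mul.mp h₂ with h₂ | h₂
      · exact h₂
      · have := hprime.dvd_factorial.mp h₂
        omega
    · have := hprime.dvd_factorial.mp h₂
      omega
  rw [clausenCoeff, (ZMod.natCast_eq_zero_iff _ _).mpr hdvd, mul_zero]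

theorem legendreSym_neg_three (hp : p ≠ 2) : legendreSym p (-3) = legendreSym 3 p := by
  rw [legendreSym.at_neg hp, legendreSym.quadratic_reciprocity' hp (by norm_num),
    ZMod.χ₄_eq_neg_one_pow ((Nat.Prime.mod_two_eq_one_iff_ne_two Fact.out).mpr hp)]
  norm_num

theorem del_eq_zero_of_mod_six (h : p % 6 = 1) : del p = 0 := by
  rw [del, legendreSym_neg_three p (by rintro rfl; omega), legendreSym.mod,
    show (p : ℤ) % (3 : ℕ) = 1 by omega, legendreSym.at_one]
  rfl

theorem del_eq_one_of_mod_six (h : p % 6 = 5) : del p = 1 := by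
  rw [del, legendreSym_neg_three p (by rintro rfl; omega), legendreSym.mod,
    show (p : ℤ) % (3 : ℕ) = 2 by omega, show legendreSym 3 2 = -1 by decide]
  rfl

/-- The coefficients of `ss3Star`, with parameters `a`, `b`. -/
def gaussCoeff (a b : ZMod p) (n : ℕ) : ZMod p :=
  poch p a n * poch p b n / ((n.factorial : ZMod p)) ^ 2 * 108 ^ n

theorem gaussCoeff_zero (a b : ZMod p) : gaussCoeff p a b 0 = 1 := by
  simp [gaussCoeff, poch]

theorem succ_sq_mul_gaussCoeff_succ (a b : ZMod p) {n : ℕ} (hn : n + 1 < p) :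
    ((n : ZMod p) + 1) ^ 2 * gaussCoeff p a b (n + 1) =
      108 * (a + n) * (b + n) * gaussCoeff p a b n := by
  have hne := natCast_ne_zero_of_pos_of_lt p n.succ_pos hn
  have hfac : (n.factorial : ZMod p) ≠ 0 := by
    rw [Ne, ZMod.natCast_eq_zero_iff, Nat.Prime.dvd_factorial Fact.out]
    omega
  push_cast at hne
  simp only [gaussCoeff, poch, ascPochhammer_succ_eval, Nat.factorial_succ]
  push_cast
  field_simp
  ring

/-- The terminating hypergeometric polynomial satisfies the recurrence in every degree. -/
theorem succ_sq_mul_coeff_truncPoly_gaussCoeff (b : ZMod p) {m : ℕ} (hm : m < p) (n : ℕ) :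
    ((n : ZMod p) + 1) ^ 2 * (truncPoly (gaussCoeff p (-m) b) m).coeff (n + 1) =
      108 * (-m + n) * (b + n) * (truncPoly (gaussCoeff p (-m) b) m).coeff n := by
  simp only [coeff_truncPoly]
  rcases lt_trichotomy n m with h | rfl | h
  · rw [if_pos (by omega), if_pos (by omega), succ_sq_mul_gaussCoeff_succ p _ _ (by omega)]
  · simp
  · rw [if_neg (by omega), if_neg (by omega), mul_zero, mul_zero]

theorem truncPoly_gaussCoeff_sq {m : ℕ} (hm : p = 6 * m + 1) :
    truncPoly (gaussCoeff p (-m) (1 / 3)) m * truncPoly (gaussCoeff p (-m) (1 / 3)) m =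
      truncPoly (clausenCoeff p) (m + m) := by
  have hp : p.Prime := Fact.out
  have hm0 : m ≠ 0 := by rintro rfl; subst hm; exact absurd hp (by norm_num)
  have h6 : 6 * (m : ZMod p) + 1 = 0 := by
    have h : ((6 * m + 1 : ℕ) : ZMod p) = 0 := by rw [← hm, ZMod.natCast_self]
    exact_mod_cast h
  have h3 : (3 : ZMod p) ≠ 0 :=
    mod_cast natCast_ne_zero_of_pos_of_lt p (n := 3) (by omega) (by omega)
  set F := truncPoly (gaussCoeff p (-m) (1 / 3)) m with hF
  have hdeg : F.natDegree ≤ m := natDegree_truncPoly_le _ _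
  have hode : eulerOp (eulerOp F) = X * (108 * eulerOp (eulerOp F) + 54 * eulerOp F + 6 * F) := by
    refine eulerOp_eulerOp_eq_of_coeff (a := 108) (b := 54) (c := 6) fun n => ?_
    rw [hF, succ_sq_mul_coeff_truncPoly_gaussCoeff p _ (by omega)]
    field_simp
    linear_combination (-18 * (1 + 3 * n) * (truncPoly (gaussCoeff p (-m) (1 / 3)) m).coeff n) * h6
  refine eq_truncPoly (natDegree_mul_le_of_le hdeg hdeg) fun n hn => ?_
  refine coeff_eq_clausenCoeff p ?_ (eulerOp_sq_of_eulerOp_eq hode) (by omega)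
  rw [mul_coeff_zero, hF, coeff_truncPoly, if_pos (by omega), gaussCoeff_zero, mul_one]

theorem one_sub_mul_truncPoly_gaussCoeff_sq {m : ℕ} (hm : p = 6 * m + 5) :
    (1 - 108 * X) *
      (truncPoly (gaussCoeff p (-m) (2 / 3)) m * truncPoly (gaussCoeff p (-m) (2 / 3)) m) =
      truncPoly (clausenCoeff p) (1 + (m + m)) := by
  have h6 : 6 * (m : ZMod p) + 5 = 0 := by
    have h : ((6 * m + 5 : ℕ) : ZMod p) = 0 := by rw [← hm, ZMod.natCast_self]
    exact_mod_cast h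
  have h3 : (3 : ZMod p) ≠ 0 :=
    mod_cast natCast_ne_zero_of_pos_of_lt p (n := 3) (by omega) (by omega)
  set F := truncPoly (gaussCoeff p (-m) (2 / 3)) m with hF
  have hdeg : F.natDegree ≤ m := natDegree_truncPoly_le _ _
  have hode : eulerOp (eulerOp F) =
      X * (108 * eulerOp (eulerOp F) + 162 * eulerOp F + 60 * F) := by
    refine eulerOp_eulerOp_eq_of_coeff (a := 108) (b := 162) (c := 60) fun n => ?_
    rw [hF, succ_sq_mul_coeff_truncPoly_gaussCoeff p _ (by omega)]
    field_simp
    linear_combination (-18 * (2 + 3 * n) * (truncPoly (gaussCoeff p (-m) (2 / 3)) m).coeff n) * h6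
  have hlin : (1 - 108 * X : (ZMod p)[X]).natDegree ≤ 1 := by compute_degree
  refine eq_truncPoly (natDegree_mul_le_of_le hlin (natDegree_mul_le_of_le hdeg hdeg))
    fun n hn => ?_
  refine coeff_eq_clausenCoeff p ?_ (eulerOp_one_sub_mul_sq_of_eulerOp_eq hode) (by omega)
  rw [mul_coeff_zero, mul_coeff_zero, hF, coeff_truncPoly, if_pos (by omega), gaussCoeff_zero]
  simp

/-- For every prime p ≥ 5, ss_p^{(3*)}(X)² = X^δ·(X − 108)^δ ·
Σ_{n=0}^{(p−1+2δ)/3} C(2n,n)²·C(3n,n)·X^{(p−1+2δ)/3 − n} in 𝔽_p[X]. -/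
theorem ss3star_sq_explicit (hp : 5 ≤ p) :
    (ss3Star p) ^ 2 =
      X ^ del p * (X - C 108) ^ del p *
        ∑ n ∈ Finset.range ((p - 1 + 2 * del p) / 3 + 1),
          C ((((2 * n).choose n : ℕ) : ZMod p) ^ 2 * (((3 * n).choose n : ℕ) : ZMod p)) *
            X ^ ((p - 1 + 2 * del p) / 3 - n) := by
  have hprime : p.Prime := Fact.out
  have h2 : ¬ 2 ∣ p := fun h => by
    have := (Nat.prime_dvd_prime_iff_eq Nat.prime_two hprime).mp h
    omega
  have h3 : ¬ 3 ∣ p := fun h => by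
    have := (Nat.prime_dvd_prime_iff_eq Nat.prime_three hprime).mp h
    omega
  obtain hmod | hmod : p % 6 = 1 ∨ p % 6 = 5 := by omega
  · have hm : p = 6 * (p / 6) + 1 := by omega
    rw [ss3Star, del_eq_zero_of_mod_six p hmod, show (p - 1 + 2 * 0) / 3 = p / 6 + p / 6 by omega]
    generalize p / 6 = m at hm ⊢
    have key := truncPoly_gaussCoeff_sq p hm
    have hdeg := natDegree_truncPoly_le (gaussCoeff p (-m) (1 / 3)) m
    have := congrArg (reflect (m + m)) key
    rw [reflect_mul _ _ hdeg hdeg, reflect_truncPoly, reflect_truncPoly] at this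
    simpa [gaussCoeff, clausenCoeff, sq] using this
  · have hm : p = 6 * (p / 6) + 5 := by omega
    rw [ss3Star, del_eq_one_of_mod_six p hmod,
      show (p - 1 + 2 * 1) / 3 = 1 + (p / 6 + p / 6) + 1 by omega]
    generalize p / 6 = m at hm ⊢
    have key := one_sub_mul_truncPoly_gaussCoeff_sq p hm
    have hdeg := natDegree_truncPoly_le (gaussCoeff p (-m) (2 / 3)) m
    have hlin : (1 - 108 * X : (ZMod p)[X]).natDegree ≤ 1 := by compute_degree
    have hrefl : reflect 1 (1 - 108 * X : (ZMod p)[X]) = X - C 108 := by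
      rw [reflect_sub, reflect_one, show (108 : (ZMod p)[X]) = C 108 from rfl, reflect_C_mul,
        reflect_one_X, pow_one, mul_one]
    have hsq := congrArg (reflect (1 + (m + m))) key
    rw [reflect_mul _ _ hlin (natDegree_mul_le_of_le hdeg hdeg), reflect_mul _ _ hdeg hdeg, hrefl,
      reflect_truncPoly, reflect_truncPoly] at hsq
    have hl : ∑ n ∈ Finset.range (m + 1), C (gaussCoeff p (-m) (2 / 3) n) * X ^ (m + 1 - n) =
        X * ∑ n ∈ Finset.range (m + 1), C (gaussCoeff p (-m) (2 / 3) n) * X ^ (m - n) := by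
      rw [Finset.mul_sum]
      refine Finset.sum_congr rfl fun n hn => ?_
      rw [show m + 1 - n = m - n + 1 by have := Finset.mem_range.mp hn; omega]
      ring
    have hr : ∑ n ∈ Finset.range (1 + (m + m) + 1 + 1),
        C (clausenCoeff p n) * X ^ (1 + (m + m) + 1 - n) =
        X * ∑ n ∈ Finset.range (1 + (m + m) + 1),
          C (clausenCoeff p n) * X ^ (1 + (m + m) - n) := by
      rw [Finset.sum_range_succ, clausenCoeff_eq_zero p (by omega) (by omega), C_0, zero_mul,
        add_zero, Finset.mul_sum]
      refine Finset.sum_congr rfl fun n hn => ?_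
      rw [show 1 + (m + m) + 1 - n = 1 + (m + m) - n + 1 by
        have := Finset.mem_range.mp hn; omega]
      ring
    have hb : (1 : ZMod p) / 3 + ((1 : ℕ) : ZMod p) / 3 = 2 / 3 := by push_cast; ring
    rw [hb]
    change (_ * ∑ n ∈ Finset.range (m + 1),
      C (gaussCoeff p (-m) (2 / 3) n) * X ^ (m + 1 - n)) ^ 2 =
      _ * ∑ n ∈ Finset.range (1 + (m + m) + 1 + 1),
        C (clausenCoeff p n) * X ^ (1 + (m + m) + 1 - n)
    rw [hl, hr, ← hsq]
    ring
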